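/- For every λ₁ ∈ (−1, 1], every real a > 0 with s = ia, and every α > 0, and for every λ₂ ∈ (−1, 1) and β > 0, the operators B(λ₁, s, α) and B(λ₂, β) on ℓ²(ℤ,ℂ) ⊕ ℓ²(ℤ,ℂ) are not unitarily equivalent. -/

import Mathlib

noncomputable section

open ContinuousLinearMap

/-- The Hilbert space `ℓ²(ℤ, ℂ)`. -/
abbrev H : Type := lp (fun _ : ℤ => ℂ) 2

/-- The standard orthonormal basis vectors of `ℓ²(ℤ, ℂ)`. -/
def e (n : ℤ) : H := lp.single 2 n 1

/-- The `2 × 2` upper-triangular block operator `[[T₁, S], [0, T₂]]` on the Hilbert space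
direct sum `E ⊕ E = WithLp 2 (E × E)`. -/
def blockOp {E : Type*} [NormedAddCommGroup E] [NormedSpace ℂ E]
    (T₁ S T₂ : E →L[ℂ] E) : WithLp 2 (E × E) →L[ℂ] WithLp 2 (E × E) :=
  ((WithLp.prodContinuousLinearEquiv 2 ℂ E E).symm :
      E × E →L[ℂ] WithLp 2 (E × E)) ∘L
    ((((T₁ ∘L fst ℂ E E) + (S ∘L snd ℂ E E)).prod (T₂ ∘L snd ℂ E E)) ∘L
      ((WithLp.prodContinuousLinearEquiv 2 ℂ E E) :
        WithLp 2 (E × E) →L[ℂ] E × E))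

/-- Unitary equivalence of bounded operators on (possibly different) complex Hilbert spaces:
there is a unitary (= surjective linear isometry) `U` with `U A U⁻¹ = B`. -/
def UnitarilyEquiv {E F : Type*} [NormedAddCommGroup E] [NormedSpace ℂ E]
    [NormedAddCommGroup F] [NormedSpace ℂ F] (A : E →L[ℂ] E) (B : F →L[ℂ] F) : Prop :=
  ∃ U : E ≃ₗᵢ[ℂ] F, ∀ x, U (A x) = B (U x)

/-- The Möbius transform `e^{iθ} (T - c·1)(1 - c̄·T)⁻¹` of an operator. -/
def mobius {E : Type*} [NormedAddCommGroup E] [NormedSpace ℂ E] [CompleteSpace E]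
    (θ : ℝ) (c : ℂ) (T : E →L[ℂ] E) : E →L[ℂ] E :=
  Complex.exp (θ * Complex.I) •
    ((T - c • (1 : E →L[ℂ] E)) * Ring.inverse (1 - (starRingEnd ℂ c) • T))

/-- A bounded operator on a complex Hilbert space is homogeneous if its spectrum lies in the
closed unit disc and all its Möbius transforms are unitarily equivalent to it. -/
def Homogeneous {E : Type*} [NormedAddCommGroup E] [NormedSpace ℂ E] [CompleteSpace E]
    (T : E →L[ℂ] E) : Prop :=
  spectrum ℂ T ⊆ Metric.closedBall 0 1 ∧
    ∀ (θ : ℝ) (c : ℂ), ‖c‖ < 1 →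
      IsUnit (1 - (starRingEnd ℂ c) • T) ∧ UnitarilyEquiv (mobius θ c T) T

/-- A bounded operator is irreducible if the only closed subspaces invariant under both the
operator and its adjoint are `{0}` and the whole space. -/
def IrreducibleOp {E : Type*} [NormedAddCommGroup E] [InnerProductSpace ℂ E] [CompleteSpace E]
    (T : E →L[ℂ] E) : Prop :=
  ∀ M : Submodule ℂ E, IsClosed (M : Set E) → (∀ x ∈ M, T x ∈ M) →
    (∀ x ∈ M, ContinuousLinearMap.adjoint T x ∈ M) → M = ⊥ ∨ M = ⊤

/-- Weight sequence of the shift `B_{λ, ia}`. -/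
def wB (l a : ℝ) (n : ℤ) : ℂ :=
  ((n : ℂ) + (1 + (l : ℂ)) / 2 + Complex.I * (a : ℂ)) /
    ((n : ℂ) + (1 + (l : ℂ)) / 2 - Complex.I * (a : ℂ))

/-- Weight sequence of the shift `T(a, b)`. -/
def wT (a b : ℝ) (n : ℤ) : ℂ := (Real.sqrt (((n : ℝ) + a) / ((n : ℝ) + b)) : ℂ)

/-- Weight sequence of the shift `S[λ]`. -/
def wS (l : ℝ) (n : ℤ) : ℂ := ((l : ℂ) + 2 * (n : ℂ) + 1)⁻¹

/-- A weighted shift acts coordinatewise. -/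
theorem weightedShift_apply {T : H →L[ℂ] H} {w : ℤ → ℂ}
    (hT : ∀ n : ℤ, T (e n) = w n • e (n + 1)) (x : H) (k : ℤ) :
    (T x) (k + 1) = w k * x k := by
  have h1 : HasSum (fun n : ℤ => lp.single 2 n (x n)) x :=
    lp.hasSum_single (by norm_num) x
  have h2 := (h1.mapL T).mapL (lp.evalCLM ℂ (fun _ : ℤ => ℂ) 2 (k + 1))
  have h3 : ∀ n : ℤ, (lp.evalCLM ℂ (fun _ : ℤ => ℂ) 2 (k + 1)) (T (lp.single 2 n (x n))) =
      if n = k then w k * x k else 0 := by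
    intro n
    have : lp.single 2 n (x n) = x n • e n := by
      rw [e, ← lp.single_smul]; simp
    rw [this, map_smul, hT]
    have : ((e (n + 1) : H) : ℤ → ℂ) (k + 1) = if n = k then 1 else 0 := by
      rw [e, lp.single_apply]
      by_cases h : n = k
      · subst h; simp
      · simp [h, Ne.symm h]
    change (x n • w n • e (n + 1) : H) (k + 1) = _
    rw [lp.coeFn_smul, Pi.smul_apply, lp.coeFn_smul, Pi.smul_apply, this]
    by_cases h : n = k
    · subst h; simp [mul_comm]
    · simp [h]
  simp only [h3] at h2
  exact h2.unique (hasSum_ite_eq k _)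

theorem inner_e_left (n : ℤ) (x : H) : inner ℂ (e n) x = x n := by
  simp [e, lp.inner_single_left]

theorem inner_e_right (n : ℤ) (x : H) : inner ℂ x (e n) = starRingEnd ℂ (x n) := by
  rw [← inner_conj_symm, inner_e_left]

theorem blockOp_fst {E : Type*} [NormedAddCommGroup E] [NormedSpace ℂ E]
    (T₁ S T₂ : E →L[ℂ] E) (x : WithLp 2 (E × E)) :
    (blockOp T₁ S T₂ x).fst = T₁ x.fst + S x.snd := rfl

theorem blockOp_snd {E : Type*} [NormedAddCommGroup E] [NormedSpace ℂ E]
    (T₁ S T₂ : E →L[ℂ] E) (x : WithLp 2 (E × E)) :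
    (blockOp T₁ S T₂ x).snd = T₂ x.snd := rfl

/-- An eigenvalue `μ` of `T* T`, where `T = [[B₁, α (B₁ - B₀)], [0, B₀]]`, coming from the block
acting on the `n`-th coordinates. -/
theorem exists_eigenvector_of_quadratic {B₀ B₁ : H →L[ℂ] H} {w : ℤ → ℂ} {α : ℝ}
    (hB₀ : ∀ n : ℤ, B₀ (e n) = e (n + 1))
    (hB₁ : ∀ n : ℤ, B₁ (e n) = w n • e (n + 1)) (n : ℤ)
    (hw : starRingEnd ℂ (w n) * w n = 1) {μ : ℝ} (hμ1 : μ ≠ 1)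
    (hμ : μ ^ 2 - (2 + α ^ 2 * Complex.normSq (w n - 1)) * μ + 1 = 0) :
    ∃ f : WithLp 2 (H × H), f ≠ 0 ∧ ∀ g : WithLp 2 (H × H),
      inner ℂ (blockOp B₁ ((α : ℂ) • (B₁ - B₀)) B₀ f)
        (blockOp B₁ ((α : ℂ) • (B₁ - B₀)) B₀ g) = (μ : ℂ) * inner ℂ f g := by
  have hB₀' : ∀ n : ℤ, B₀ (e n) = (fun _ => (1 : ℂ)) n • e (n + 1) := by simpa using hB₀
  set p : ℂ := α * (1 - starRingEnd ℂ (w n)) with hp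
  set q : ℂ := (μ : ℂ) - 1 with hq
  have hμ' : (μ : ℂ) ^ 2 - (2 + α ^ 2 * ((starRingEnd ℂ (w n) - 1) * (w n - 1))) * μ + 1 = 0 := by
    have := congrArg (fun r : ℝ => (r : ℂ)) hμ
    push_cast at this
    rw [Complex.normSq_eq_conj_mul_self] at this
    simpa using this
  refine ⟨WithLp.toLp 2 (p • e n, q • e n), ?_, ?_⟩
  · intro h
    have h1 : q • e n = 0 := congrArg (fun z : WithLp 2 (H × H) => z.snd) h
    have h2 : q * inner ℂ (e n) (e n) = 0 := by
      rw [← inner_smul_right, h1, inner_zero_right]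
    have h3 : inner ℂ (e n) (e n) = (1 : ℂ) := by rw [inner_e_left]; simp [e]
    rw [h3, mul_one, hq, sub_eq_zero] at h2
    exact hμ1 (by exact_mod_cast h2)
  · intro g
    rw [WithLp.prod_inner_apply, WithLp.prod_inner_apply]
    change inner ℂ (blockOp _ _ _ _).fst (blockOp _ _ _ _).fst +
      inner ℂ (blockOp _ _ _ _).snd (blockOp _ _ _ _).snd =
      (μ : ℂ) * (inner ℂ (p • e n) g.fst + inner ℂ (q • e n) g.snd)
    simp only [blockOp_fst, blockOp_snd]
    change inner ℂ (B₁ (p • e n) + ((α : ℂ) • (B₁ - B₀)) (q • e n)) _ +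
      inner ℂ (B₀ (q • e n)) _ = _
    have key : B₁ (p • e n) + ((α : ℂ) • (B₁ - B₀)) (q • e n) =
        (w n * p + α * (w n - 1) * q) • e (n + 1) := by
      simp only [map_smul, smul_apply, sub_apply, hB₀, hB₁]
      module
    rw [key, map_smul, hB₀]
    simp only [inner_smul_left, inner_e_left, smul_apply, sub_apply, lp.coeFn_add, lp.coeFn_smul,
      lp.coeFn_sub, Pi.add_apply, Pi.smul_apply, Pi.sub_apply, smul_eq_mul,
      weightedShift_apply hB₀', weightedShift_apply hB₁, hp, hq, map_add, map_sub, map_mul,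
      Complex.conj_conj, Complex.conj_ofReal, map_one, one_mul]
    linear_combination ((α * (μ - w n) * g.fst n - α ^ 2 * (w n - 1) * g.snd n) * hw
      - g.snd n * hμ')

/-- Eigenvalues of `T* T`, where `T = [[B₀, β S], [0, B₀]]`, are roots of the characteristic
polynomial of one of the coordinate blocks. -/
theorem exists_quadratic_of_eigenvector {B₀ S : H →L[ℂ] H} {u : ℤ → ℝ} {β : ℝ}
    (hB₀ : ∀ n : ℤ, B₀ (e n) = e (n + 1))
    (hS : ∀ n : ℤ, S (e n) = (u n : ℂ) • e (n + 1)) {μ : ℝ}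
    {f : WithLp 2 (H × H)} (hf : f ≠ 0)
    (h : ∀ g : WithLp 2 (H × H), inner ℂ (blockOp B₀ ((β : ℂ) • S) B₀ f)
        (blockOp B₀ ((β : ℂ) • S) B₀ g) = (μ : ℂ) * inner ℂ f g) :
    ∃ k : ℤ, μ ^ 2 - (2 + β ^ 2 * u k ^ 2) * μ + 1 = 0 := by
  have hB₀' : ∀ n : ℤ, B₀ (e n) = (fun _ => (1 : ℂ)) n • e (n + 1) := by simpa using hB₀
  obtain ⟨k, hk⟩ : ∃ k : ℤ, f.fst k ≠ 0 ∨ f.snd k ≠ 0 := by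
    by_contra! hc
    apply hf
    have h1 : f.fst = 0 := by ext k; simpa using (hc k).1
    have h2 : f.snd = 0 := by ext k; simpa using (hc k).2
    exact (WithLp.equiv 2 (H × H)).injective (Prod.ext h1 h2)
  refine ⟨k, ?_⟩
  have e1 := h (WithLp.toLp 2 (e k, 0))
  have e2 := h (WithLp.toLp 2 (0, e k))
  rw [WithLp.prod_inner_apply, WithLp.prod_inner_apply] at e1 e2
  change inner ℂ (blockOp _ _ _ _).fst (B₀ (e k) + ((β : ℂ) • S) 0) +
      inner ℂ (blockOp _ _ _ _).snd (B₀ 0) =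
      (μ : ℂ) * (inner ℂ f.fst (e k) + inner ℂ f.snd 0) at e1
  change inner ℂ (blockOp _ _ _ _).fst (B₀ 0 + ((β : ℂ) • S) (e k)) +
      inner ℂ (blockOp _ _ _ _).snd (B₀ (e k)) =
      (μ : ℂ) * (inner ℂ f.fst 0 + inner ℂ f.snd (e k)) at e2
  simp only [blockOp_fst, blockOp_snd, map_zero, hB₀, hS, smul_apply, inner_zero_right, add_zero,
    zero_add, inner_smul_right, inner_e_right, lp.coeFn_add, lp.coeFn_smul, Pi.add_apply,
    Pi.smul_apply, smul_eq_mul, weightedShift_apply hB₀', weightedShift_apply hS, map_add, map_mul,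
    Complex.conj_ofReal, one_mul] at e1 e2
  set F := starRingEnd ℂ (f.fst k) with hF
  set G := starRingEnd ℂ (f.snd k) with hG
  have hFG : F ≠ 0 ∨ G ≠ 0 := by simpa [hF, hG] using hk
  have hz : ((μ : ℂ) ^ 2 - (2 + β ^ 2 * u k ^ 2) * μ + 1) = 0 := by
    rcases hFG with h0 | h0
    · refine (mul_eq_zero.mp ?_).resolve_right h0
      linear_combination (1 + (β : ℂ) ^ 2 * u k ^ 2 - μ) * e1 - β * u k * e2
    · refine (mul_eq_zero.mp ?_).resolve_right h0
      linear_combination (1 - (μ : ℂ)) * e2 - β * u k * e1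
  exact_mod_cast hz

theorem sqrt_add_sq_strict_midpoint {a : ℝ} (ha : 0 < a) {x : ℝ} (hx : 0 < x) :
    2 * √((x + 1) ^ 2 + a ^ 2) < √(x ^ 2 + a ^ 2) + √((x + 2) ^ 2 + a ^ 2) := by
  have h0 := Real.sq_sqrt (show 0 ≤ x ^ 2 + a ^ 2 by positivity)
  have h1 := Real.sq_sqrt (show 0 ≤ (x + 1) ^ 2 + a ^ 2 by positivity)
  have h2 := Real.sq_sqrt (show 0 ≤ (x + 2) ^ 2 + a ^ 2 by positivity)
  have p0 := Real.sqrt_nonneg (x ^ 2 + a ^ 2)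
  have p2 := Real.sqrt_nonneg ((x + 2) ^ 2 + a ^ 2)
  set g0 := √(x ^ 2 + a ^ 2)
  set g1 := √((x + 1) ^ 2 + a ^ 2)
  set g2 := √((x + 2) ^ 2 + a ^ 2)
  have hc : x * (x + 2) + a ^ 2 < g0 * g2 := by
    refine lt_of_pow_lt_pow_left₀ 2 (by positivity) ?_
    rw [mul_pow, h0, h2]
    nlinarith [mul_pos ha ha]
  refine lt_of_pow_lt_pow_left₀ 2 (by positivity) ?_
  nlinarith

theorem tendsto_sqrt_add_sq_sub (a : ℝ) :
    Filter.Tendsto (fun x : ℝ => √(x ^ 2 + a ^ 2) - x) Filter.atTop (nhds 0) := by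
  have hlim : Filter.Tendsto (fun x : ℝ => a ^ 2 / x) Filter.atTop (nhds 0) :=
    Filter.Tendsto.const_div_atTop Filter.tendsto_id _
  refine squeeze_zero' ?_ ?_ hlim
  · filter_upwards with x
    exact sub_nonneg.mpr (Real.le_sqrt_of_sq_le (by nlinarith [sq_nonneg a]))
  · filter_upwards [Filter.eventually_gt_atTop 0] with x hx
    rw [sub_le_iff_le_add]
    refine Real.sqrt_le_iff.mpr ⟨by positivity, ?_⟩
    have : (a ^ 2 / x + x) ^ 2 = (a ^ 2 / x) ^ 2 + 2 * a ^ 2 + x ^ 2 := by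
      field_simp
      ring
    rw [this]
    nlinarith [sq_nonneg (a ^ 2 / x), sq_nonneg a]

/-- The positive part of a finite union of cosets of `ℤ` is bounded away from `0`. -/
theorem exists_pos_forall_le_int_add (s : Finset ℤ) (d : ℝ) :
    ∃ ε : ℝ, 0 < ε ∧ ∀ j ∈ s, ∀ m : ℤ, 0 < (m : ℝ) + j * d → ε ≤ m + j * d := by
  induction s using Finset.induction_on with
  | empty => exact ⟨1, one_pos, by simp⟩
  | insert i s _ ih =>
    obtain ⟨ε, hε, h⟩ := ih
    have hpos : 0 < (⌊-(i * d)⌋ : ℝ) + 1 + i * d := by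
      linarith [Int.lt_floor_add_one (-((i : ℝ) * d))]
    refine ⟨min ε (⌊-(i * d)⌋ + 1 + i * d), lt_min hε hpos, ?_⟩
    intro j hj m hm
    rcases Finset.mem_insert.mp hj with rfl | hj
    · refine (min_le_right _ _).trans ?_
      have : ⌊-((j : ℝ) * d)⌋ < m := Int.floor_lt.mpr (by linarith)
      have : (⌊-((j : ℝ) * d)⌋ : ℝ) + 1 ≤ m := by exact_mod_cast this
      linarith
    · exact (min_le_left _ _).trans (h j hj m hm)

/-- The numbers `κ ((n + c)² + a²)` are not all squares of elements of `ℤ + d`. -/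
theorem not_forall_exists_sq_eq {κ a c d : ℝ} (hκ : 0 < κ) (ha : 0 < a) (hc : 0 ≤ c)
    (h : ∀ n : ℤ, ∃ k : ℤ, ((k : ℝ) + d) ^ 2 = κ * ((n + c) ^ 2 + a ^ 2)) : False := by
  have hz : ∀ n : ℤ, ∃ m j : ℤ, (j = 1 ∨ j = -1) ∧
      √κ * √((n + c) ^ 2 + a ^ 2) = m + j * d := by
    intro n
    obtain ⟨k, hk⟩ := h n
    rw [← Real.sqrt_mul hκ.le, ← hk, Real.sqrt_sq_eq_abs]
    rcases abs_choice ((k : ℝ) + d) with h1 | h1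
    · exact ⟨k, 1, Or.inl rfl, by rw [h1]; push_cast; ring⟩
    · exact ⟨-k, -1, Or.inr rfl, by rw [h1]; push_cast; ring⟩
  obtain ⟨ε, hε, hmin⟩ := exists_pos_forall_le_int_add (Finset.Icc (-4) 4) d
  have ht : ∀ r : ℝ, Filter.Tendsto
      (fun n : ℕ => √((((n : ℝ) + c) + r) ^ 2 + a ^ 2) - (((n : ℝ) + c) + r))
      Filter.atTop (nhds 0) := fun r =>
    (tendsto_sqrt_add_sq_sub a).comp (Filter.tendsto_atTop_add_const_right _ _
      (Filter.tendsto_atTop_add_const_right _ _ tendsto_natCast_atTop_atTop))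
  have hlim := (((ht 0).add (ht 2)).sub ((ht 1).const_mul 2)).const_mul √κ
  simp only [mul_zero, add_zero, sub_zero] at hlim
  obtain ⟨n, hn, hn0⟩ := ((hlim.eventually (gt_mem_nhds hε)).and
    (Filter.eventually_gt_atTop 0)).exists
  have hn0' : (0 : ℝ) < n + c := by
    have : (0 : ℝ) < n := by exact_mod_cast hn0
    linarith
  have hconv := mul_lt_mul_of_pos_left (sqrt_add_sq_strict_midpoint ha hn0') (Real.sqrt_pos.mpr hκ)
  obtain ⟨m0, j0, hj0, h0⟩ := hz n
  obtain ⟨m1, j1, hj1, h1⟩ := hz (n + 1)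
  obtain ⟨m2, j2, hj2, h2⟩ := hz (n + 2)
  push_cast at h0 h1 h2
  rw [show (n : ℝ) + 1 + c = n + c + 1 by ring] at h1
  rw [show (n : ℝ) + 2 + c = n + c + 2 by ring] at h2
  have := hmin (j0 + j2 - 2 * j1) (by rw [Finset.mem_Icc]; omega) (m0 + m2 - 2 * m1)
    (by push_cast; linarith)
  push_cast at this
  linarith

/-- no `B(λ₁, ia, α)` is unitarily equivalent to any `B(λ₂, β)`. -/
theorem stmt5 (l₁ a α : ℝ) (hl₁ : -1 < l₁ ∧ l₁ ≤ 1) (ha : 0 < a) (hα : 0 < α)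
    (l₂ β : ℝ) (hl₂ : -1 < l₂ ∧ l₂ < 1) (hβ : 0 < β)
    (B₀ B₁ Sl : H →L[ℂ] H)
    (hB₀ : ∀ n : ℤ, B₀ (e n) = e (n + 1))
    (hB₁ : ∀ n : ℤ, B₁ (e n) = wB l₁ a n • e (n + 1))
    (hSl : ∀ n : ℤ, Sl (e n) = wS l₂ n • e (n + 1)) :
    ¬ UnitarilyEquiv (blockOp B₁ ((α : ℂ) • (B₁ - B₀)) B₀)
        (blockOp B₀ ((β : ℂ) • Sl) B₀) := by
  rintro ⟨U, hU⟩
  have hS : ∀ n : ℤ, Sl (e n) = (((l₂ + 2 * n + 1)⁻¹ : ℝ) : ℂ) • e (n + 1) := by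
    intro n
    rw [hSl, wS]
    push_cast
    rfl
  refine not_forall_exists_sq_eq (κ := β ^ 2 / (16 * α ^ 2 * a ^ 2)) (a := a)
    (c := (1 + l₁) / 2) (d := (1 + l₂) / 2) (by positivity) ha (by linarith) fun n => ?_
  set x : ℝ := n + (1 + l₁) / 2 with hx
  have hxa : 0 < x ^ 2 + a ^ 2 := by positivity
  have hwx : wB l₁ a n = ((x : ℂ) + Complex.I * a) / ((x : ℂ) - Complex.I * a) := by
    rw [wB, hx]; push_cast; rfl
  have hd : (x : ℂ) - Complex.I * a ≠ 0 := by
    intro h0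
    have := congrArg Complex.im h0
    simp at this
    exact ha.ne' this
  have hd' : (x : ℂ) + Complex.I * a ≠ 0 := by
    intro h0
    have := congrArg Complex.im h0
    simp at this
    exact ha.ne' this
  have hw : starRingEnd ℂ (wB l₁ a n) * wB l₁ a n = 1 := by
    rw [hwx, map_div₀, map_add, map_sub, map_mul, Complex.conj_I, Complex.conj_ofReal,
      Complex.conj_ofReal, neg_mul, sub_neg_eq_add, ← sub_eq_add_neg]
    field_simp
  have hnorm : Complex.normSq (wB l₁ a n - 1) = 4 * a ^ 2 / (x ^ 2 + a ^ 2) := by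
    have : wB l₁ a n - 1 = (2 * Complex.I * a) / ((x : ℂ) - Complex.I * a) := by
      rw [hwx]; field_simp; ring
    rw [this, Complex.normSq_div]
    simp [Complex.normSq_apply]
    ring
  set t : ℝ := α ^ 2 * Complex.normSq (wB l₁ a n - 1) with ht
  have htpos : 0 < t := by rw [ht, hnorm]; positivity
  obtain ⟨μ, hμ⟩ : ∃ μ : ℝ, μ ^ 2 - (2 + t) * μ + 1 = 0 := by
    refine ⟨(2 + t + √(t ^ 2 + 4 * t)) / 2, ?_⟩
    have := Real.sq_sqrt (show 0 ≤ t ^ 2 + 4 * t by positivity)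
    linear_combination this / 4
  have hμ1 : μ ≠ 1 := by
    rintro rfl
    linarith
  have hμ0 : μ ≠ 0 := by
    rintro rfl
    norm_num at hμ
  obtain ⟨f, hf, hfe⟩ := exists_eigenvector_of_quadratic hB₀ hB₁ n hw hμ1 hμ
  obtain ⟨k, hk⟩ := exists_quadratic_of_eigenvector (f := U f) (μ := μ) (β := β) hB₀ hS
    (by simpa using hf) (fun g => by
      have := hfe (U.symm g)
      rw [← U.inner_map_map, hU, hU, ← U.inner_map_map f, U.apply_symm_apply] at this
      exact this)
  have htk : t = β ^ 2 * (l₂ + 2 * k + 1)⁻¹ ^ 2 :=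
    mul_right_cancel₀ hμ0 (by linear_combination hk - hμ)
  have hy : l₂ + 2 * k + 1 ≠ 0 := by
    intro h0
    rw [h0] at htk
    norm_num at htk
    exact htpos.ne' htk
  refine ⟨k, ?_⟩
  rw [ht, hnorm] at htk
  field_simp at htk ⊢
  linear_combination 4 * htk
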